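/- arXiv:0801.3567 — 2 statements merged into one kernel-verified Lean document; each statement's English description precedes it below -/
import Mathlib

section
/- For μ-almost every x ∈ [0,1], the Kantorovich distance κ( 𝒜_n(x), 𝒩(0, σ_v²) ) between the weighted empirical measure 𝒜_n(x) and the centered Gaussian law with variance σ_v² tends to 0 as n → ∞. (In particular 𝒜_n(x) converges weakly to 𝒩(0, σ_v²) for μ-almost every x.) -/
open MeasureTheory Set Filter Topology

/-- The Kantorovich distance between two probability measures on `ℝ`:
`κ(μ₁,μ₂) = sup {∫ g d(μ₁ - μ₂) : g 1-Lipschitz}`. -/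
noncomputable def kantorovichDist (μ₁ μ₂ : MeasureTheory.Measure ℝ) : ℝ :=
  sSup {r : ℝ | ∃ g : ℝ → ℝ, LipschitzWith 1 g ∧
    r = (∫ ξ, g ξ ∂μ₁) - (∫ ξ, g ξ ∂μ₂)}

/-- The weighted empirical measure of the normalized Birkhoff sums:
`𝒜_n(x) = (1/D_n) ∑_{k=1}^n (1/k) δ_{S_k v(x)/√k}`, `D_n = ∑_{k=1}^n 1/k`. -/
noncomputable def weightedEmpirical (T : ℝ → ℝ) (v : ℝ → ℝ) (n : ℕ) (x : ℝ) :
    MeasureTheory.Measure ℝ :=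
  (ENNReal.ofReal (∑ k ∈ Finset.Icc 1 n, (1:ℝ) / k))⁻¹ •
    ∑ k ∈ Finset.Icc 1 n, ENNReal.ofReal ((1:ℝ) / k) •
      MeasureTheory.Measure.dirac
        ((∑ j ∈ Finset.range k, v (T^[j] x)) / Real.sqrt k)


namespace ASCLT

/-- convergence of distribution functions gives weak convergence -/
lemma weak_of_cdf (P : ℕ → ProbabilityMeasure ℝ) (Q : ProbabilityMeasure ℝ)
    (hP : ∀ t : ℝ, Tendsto (fun n => (P n : Measure ℝ).real (Iic t)) atTop
      (𝓝 ((Q : Measure ℝ).real (Iic t)))) : Tendsto P atTop (𝓝 Q) := by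
  have hS := isPiSystem_Ioc (fun x : ℝ => x) (fun x : ℝ => x)
  refine hS.tendsto_probabilityMeasure_of_tendsto_of_mem ?_ ?_ ?_
  · rintro s ⟨a, b, _, rfl⟩
    exact measurableSet_Ioc
  · intro u hu x hx
    obtain ⟨ε, hε, hb⟩ := Metric.isOpen_iff.1 hu x hx
    refine ⟨Ioc (x - ε/2) (x + ε/2), ⟨x - ε/2, x + ε/2, by linarith, rfl⟩,
      Ioc_mem_nhds (by linarith) (by linarith), ?_⟩
    refine Subset.trans ?_ hb
    intro y hy
    rw [Metric.mem_ball, Real.dist_eq, abs_lt]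
    constructor <;> linarith [hy.1, hy.2]
  · rintro s ⟨a, b, hab, rfl⟩
    have key : ∀ R : ProbabilityMeasure ℝ, (R : Measure ℝ).real (Ioc a b)
        = (R : Measure ℝ).real (Iic b) - (R : Measure ℝ).real (Iic a) := by
      intro R
      rw [show Ioc a b = Iic b \ Iic a by ext; simp [and_comm], measureReal_sdiff (Iic_subset_Iic.2 hab.le) measurableSet_Iic]
    have h1 : Tendsto (fun n => (P n : Measure ℝ).real (Ioc a b)) atTop
      (𝓝 ((Q : Measure ℝ).real (Ioc a b))) := by
      simp_rw [key]
      exact (hP b).sub (hP a)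
    simpa using h1

lemma lip_integrable {ν : Measure ℝ} [IsFiniteMeasure ν] (hi : Integrable (fun x : ℝ => x) ν)
    {f : ℝ → ℝ} {L : NNReal} (hf : LipschitzWith L f) : Integrable f ν := by
  have : Integrable (fun x : ℝ => |f 0| + L * |x|) ν :=
    (integrable_const _).add (hi.abs.const_mul _)
  refine this.mono' hf.continuous.aestronglyMeasurable (Eventually.of_forall fun x => ?_)
  have := hf.dist_le_mul x 0
  rw [Real.dist_eq, Real.dist_eq, sub_zero] at this
  rw [Real.norm_eq_abs]
  have h2 : |f x| ≤ |f x - f 0| + |f 0| := by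
    simpa using abs_add_le (f x - f 0) (f 0)
  linarith

lemma id_integrable {ν : Measure ℝ} [IsFiniteMeasure ν]
    (hi : Integrable (fun x : ℝ => x^2) ν) : Integrable (fun x : ℝ => x) ν := by
  have : Integrable (fun x : ℝ => 1 + x^2) ν := (integrable_const _).add hi
  refine this.mono' (by fun_prop) (Eventually.of_forall fun x => ?_)
  rw [Real.norm_eq_abs, abs_le]
  constructor <;> nlinarith [sq_nonneg (x-1), sq_nonneg (x+1)]

lemma trunc_bound {ν : Measure ℝ} [IsProbabilityMeasure ν]
    (hi : Integrable (fun x : ℝ => x^2) ν) {C : ℝ} (hC : ∫ x, x^2 ∂ν ≤ C)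
    {f : ℝ → ℝ} {L : NNReal} (hf : LipschitzWith L f) (hf0 : ∀ x, 0 ≤ f x)
    {R : ℝ} (hR : 0 < R) :
    |(∫ x, f x ∂ν) - ∫ x, min (f x) R ∂ν| ≤ (2 * (f 0)^2 + 2 * L^2 * C) / R := by
  have hid := id_integrable hi
  have h1 : Integrable f ν := lip_integrable hid hf
  have h2 : Integrable (fun x => min (f x) R) ν := by
    refine h1.mono' (by have := hf.continuous; fun_prop) (Eventually.of_forall fun x => ?_)
    rw [Real.norm_eq_abs, abs_of_nonneg (le_min (hf0 x) hR.le)]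
    exact min_le_left _ _
  rw [← integral_sub h1 h2]
  refine (abs_integral_le_integral_abs).trans ?_
  have h3 : Integrable (fun x : ℝ => (2 * (f 0)^2 + 2 * L^2 * x^2) / R) ν :=
    ((integrable_const _).add (hi.const_mul _)).div_const _
  refine (integral_mono (h1.sub h2).abs h3 ?_).trans ?_
  · intro x
    have hl := hf.dist_le_mul x 0
    rw [Real.dist_eq, Real.dist_eq, sub_zero] at hl
    have hfx : f x ≤ f 0 + L * |x| := by linarith [le_abs_self (f x - f 0)]
    have hsq : (f x)^2 ≤ 2 * (f 0)^2 + 2 * L^2 * x^2 := by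
      have : (f x)^2 ≤ (f 0 + L * |x|)^2 := pow_le_pow_left₀ (hf0 x) hfx 2
      have h4 : (L * |x|)^2 = L^2 * x^2 := by rw [mul_pow, sq_abs]
      nlinarith [sq_nonneg (f 0 - L * |x|)]
    show |f x - min (f x) R| ≤ _
    rw [le_div_iff₀ hR]
    refine le_trans ?_ hsq
    rcases le_total (f x) R with h | h
    · rw [min_eq_left h]; simp; positivity
    · rw [min_eq_right h, abs_of_nonneg (by linarith)]
      nlinarith [hf0 x]
  · rw [integral_div, integral_add (integrable_const _) (hi.const_mul _),
      integral_const_mul (2 * (L:ℝ)^2)]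
    simp only [integral_const, probReal_univ, smul_eq_mul, one_mul]
    gcongr

lemma lip_expect (P : ℕ → ProbabilityMeasure ℝ) (Q : ProbabilityMeasure ℝ)
    (hPQ : Tendsto P atTop (𝓝 Q)) (C : ℝ)
    (hi : ∀ n, Integrable (fun x : ℝ => x^2) (P n : Measure ℝ))
    (hC : ∀ n, ∫ x, x^2 ∂(P n : Measure ℝ) ≤ C)
    (hiQ : Integrable (fun x : ℝ => x^2) (Q : Measure ℝ))
    {f : ℝ → ℝ} {L : NNReal} (hf : LipschitzWith L f) (hf0 : ∀ x, 0 ≤ f x) :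
    Tendsto (fun n => ∫ x, f x ∂(P n : Measure ℝ)) atTop (𝓝 (∫ x, f x ∂(Q : Measure ℝ))) := by
  set A : ℝ := 2 * (f 0)^2 + 2 * L^2 * C with hA
  set B : ℝ := 2 * (f 0)^2 + 2 * L^2 * (∫ x, x^2 ∂(Q : Measure ℝ)) with hB
  have hC0 : 0 ≤ C := (integral_nonneg (fun x => sq_nonneg _)).trans (hC 0)
  have hQ0 : 0 ≤ ∫ x, x^2 ∂(Q : Measure ℝ) := integral_nonneg (fun x => sq_nonneg _)
  have hA0 : 0 ≤ A := by positivity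
  have hB0 : 0 ≤ B := by positivity
  rw [Metric.tendsto_atTop]
  intro ε hε
  set R : ℝ := 4 * (A + B + 1) / ε with hRdef
  have hR : 0 < R := by positivity
  have hR2 : (A + B) / R ≤ ε / 4 := by
    rw [hRdef, div_div_eq_mul_div, div_le_iff₀ (by positivity)]
    nlinarith
  let F : BoundedContinuousFunction ℝ ℝ :=
    BoundedContinuousFunction.ofNormedAddCommGroup (fun x => min (f x) R)
      (by have := hf.continuous; fun_prop) R (fun x => by
        rw [Real.norm_eq_abs, abs_of_nonneg (le_min (hf0 x) hR.le)]; exact min_le_right _ _)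
  have hw := ProbabilityMeasure.tendsto_iff_forall_integral_tendsto.1 hPQ F
  obtain ⟨N, hN⟩ := Metric.tendsto_atTop.1 hw (ε/2) (by linarith)
  refine ⟨N, fun n hn => ?_⟩
  have h1 := trunc_bound (hi n) (hC n) hf hf0 hR
  have h2 := trunc_bound hiQ le_rfl hf hf0 hR
  have h3 := hN n hn
  rw [Real.dist_eq] at h3 ⊢
  have h3' : |(∫ x, min (f x) R ∂(P n : Measure ℝ)) - ∫ x, min (f x) R ∂(Q : Measure ℝ)| < ε/2 := h3
  rw [← hA] at h1
  rw [← hB] at h2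
  rw [add_div] at hR2
  rw [abs_le] at h1 h2
  rw [abs_lt] at h3' ⊢
  constructor <;> linarith [h1.1, h1.2, h2.1, h2.2, h3'.1, h3'.2]

/-- harmonic sums -/
noncomputable def H (n : ℕ) : ℝ := ∑ k ∈ Finset.Icc 1 n, (1:ℝ) / k

lemma H_succ (n : ℕ) : H (n+1) = H n + 1 / ((n:ℝ)+1) := by
  unfold H
  rw [Finset.sum_Icc_succ_top (by omega)]
  push_cast; rfl

lemma H_zero : H 0 = 0 := by simp [H]

lemma H_mono : Monotone H := monotone_nat_of_le_succ fun n => by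
  rw [H_succ]; have : 0 ≤ 1 / ((n:ℝ)+1) := by positivity
  linarith

lemma H_le_succ (n : ℕ) : H (n+1) ≤ H n + 1 := by
  rw [H_succ]
  have : 1 / ((n:ℝ)+1) ≤ 1 := by
    rw [div_le_one (by positivity)]; linarith [Nat.cast_nonneg (α := ℝ) n]
  linarith

lemma H_range (n : ℕ) : H n = ∑ i ∈ Finset.range n, 1 / ((i:ℝ)+1) := by
  induction n with
  | zero => simp [H]
  | succ n ih => rw [H_succ, Finset.sum_range_succ, ih]

lemma H_tendsto : Tendsto H atTop atTop := by
  have := Real.tendsto_sum_range_one_div_nat_succ_atTop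
  refine this.congr fun n => (H_range n).symm

lemma H_pos {n : ℕ} (hn : 1 ≤ n) : 0 < H n := by
  have := H_mono hn
  have h1 : H 1 = 1 := by simp [H]
  linarith

lemma exists_seq (k : ℕ) : ∃ n : ℕ, (k:ℝ)^2 ≤ H n ∧ H n ≤ (k:ℝ)^2 + 1 ∧
    ∀ m, (k:ℝ)^2 ≤ H m → n ≤ m := by
  classical
  have hex : ∃ n, (k:ℝ)^2 ≤ H n := (H_tendsto.eventually_ge_atTop _).exists
  refine ⟨Nat.find hex, Nat.find_spec hex, ?_, fun m hm => Nat.find_min' hex hm⟩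
  rcases h : Nat.find hex with _ | m
  · rw [H_zero]; positivity
  · have := Nat.find_min hex (m := m) (by omega)
    linarith [H_le_succ m]

lemma interp (N : ℕ → ℕ) (hN : ∀ k : ℕ, ((k:ℝ)^2 ≤ H (N k) ∧ H (N k) ≤ (k:ℝ)^2 + 1 ∧
    ∀ m, (k:ℝ)^2 ≤ H m → N k ≤ m)) (W : ℕ → ℝ) (hW : Monotone W) (hW0 : ∀ n, 0 ≤ W n)
    (c : ℝ) (hc : Tendsto (fun k => W (N k) / H (N k)) atTop (𝓝 c)) :
    Tendsto (fun n => W n / H n) atTop (𝓝 c) := by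
  let κ : ℕ → ℕ := fun n => ⌊Real.sqrt (H n)⌋₊
  have hκ : Tendsto κ atTop atTop :=
    tendsto_nat_floor_atTop.comp (Real.tendsto_sqrt_atTop.comp H_tendsto)
  have hH0 : ∀ n, 0 ≤ H n := fun n => by have := H_mono (Nat.zero_le n); rwa [H_zero] at this
  have k1 : ∀ n, (κ n : ℝ)^2 ≤ H n := fun n => by
    have := Nat.floor_le (Real.sqrt_nonneg (H n))
    calc (κ n : ℝ)^2 ≤ (Real.sqrt (H n))^2 := pow_le_pow_left₀ (by positivity) this 2
      _ = H n := Real.sq_sqrt (hH0 n)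
  have k2 : ∀ n, H n < ((κ n + 1 : ℕ) : ℝ)^2 := fun n => by
    have := Nat.lt_floor_add_one (Real.sqrt (H n))
    calc H n = (Real.sqrt (H n))^2 := (Real.sq_sqrt (hH0 n)).symm
      _ < _ := by
        push_cast
        exact pow_lt_pow_left₀ this (Real.sqrt_nonneg _) (by norm_num)
  have hinv : Tendsto (fun k : ℕ => 1 / (k:ℝ)) atTop (𝓝 0) := tendsto_one_div_atTop_nhds_zero_nat
  -- ratio limits
  have r1 : Tendsto (fun k : ℕ => (k:ℝ)^2 / ((k:ℝ)+1)^2) atTop (𝓝 1) := by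
    have : Tendsto (fun k : ℕ => 1 / (1 + 1 / (k:ℝ))^2) atTop (𝓝 (1 / (1+0)^2)) :=
      tendsto_const_nhds.div ((tendsto_const_nhds.add hinv).pow 2) (by norm_num)
    rw [show (1:ℝ) / (1+0)^2 = 1 by norm_num] at this
    refine this.congr' ?_
    filter_upwards [eventually_ge_atTop 1] with k hk
    have : (0:ℝ) < k := by exact_mod_cast hk
    field_simp
  have r2 : Tendsto (fun k : ℕ => (((k:ℝ)+1)^2 + 1) / (k:ℝ)^2) atTop (𝓝 1) := by
    have : Tendsto (fun k : ℕ => (1 + 1 / (k:ℝ))^2 + (1 / (k:ℝ))^2) atTop (𝓝 ((1+0)^2 + 0^2)) :=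
      ((tendsto_const_nhds.add hinv).pow 2).add (hinv.pow 2)
    rw [show (1+0)^2 + 0^2 = (1:ℝ) by norm_num] at this
    refine this.congr' ?_
    filter_upwards [eventually_ge_atTop 1] with k hk
    have : (0:ℝ) < k := by exact_mod_cast hk
    field_simp
  have lo := (hc.mul r1).comp hκ
  have hi := ((hc.comp (tendsto_add_atTop_nat 1)).mul r2).comp hκ
  rw [mul_one] at lo hi
  refine tendsto_of_tendsto_of_tendsto_of_le_of_le' lo hi ?_ ?_
  · filter_upwards [hκ.eventually_ge_atTop 1] with n hn
    have hk : (1:ℝ) ≤ κ n := by exact_mod_cast hn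
    have h1 : N (κ n) ≤ n := (hN _).2.2 n (k1 n)
    have h2 := hW h1
    have h3 := (hN (κ n)).1
    have hp : 0 < H (N (κ n)) := by nlinarith
    have hp' : 0 < H n := by nlinarith [k1 n]
    show W (N (κ n)) / H (N (κ n)) * ((κ n : ℝ)^2 / ((κ n : ℝ)+1)^2) ≤ W n / H n
    have e1 : (κ n : ℝ)^2 / ((κ n : ℝ)+1)^2 ≤ H (N (κ n)) / H n := by
      have := k2 n
      push_cast at this
      gcongr
    calc _ ≤ W (N (κ n)) / H (N (κ n)) * (H (N (κ n)) / H n) := by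
          have := hW0 (N (κ n)); gcongr
      _ = W (N (κ n)) / H n := by field_simp
      _ ≤ _ := by gcongr
  · filter_upwards [hκ.eventually_ge_atTop 1] with n hn
    have hk : (1:ℝ) ≤ κ n := by exact_mod_cast hn
    have h1 : n ≤ N (κ n + 1) := by
      by_contra hlt
      have := H_mono (le_of_not_ge hlt)
      linarith [k2 n, (hN (κ n + 1)).1]
    have h2 := hW h1
    have h3 := (hN (κ n + 1)).1
    have h4 := (hN (κ n + 1)).2.1
    push_cast at h3 h4
    have hp : 0 < H (N (κ n + 1)) := by nlinarith
    have hp' : 0 < H n := by nlinarith [k1 n]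
    show W n / H n ≤ W (N (κ n + 1)) / H (N (κ n + 1)) * ((((κ n : ℝ)+1)^2 + 1) / (κ n : ℝ)^2)
    have e1 : H (N (κ n + 1)) / H n ≤ (((κ n : ℝ)+1)^2 + 1) / (κ n : ℝ)^2 := by
      have := k1 n
      gcongr
    calc W n / H n ≤ W (N (κ n + 1)) / H n := by gcongr
      _ = W (N (κ n + 1)) / H (N (κ n + 1)) * (H (N (κ n + 1)) / H n) := by field_simp
      _ ≤ _ := by have := hW0 (N (κ n + 1)); gcongr

/-- weighted Cesaro -/
lemma log_cesaro (a : ℕ → ℝ) (c : ℝ) (ha : Tendsto a atTop (𝓝 c)) :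
    Tendsto (fun n : ℕ => (∑ k ∈ Finset.Icc 1 n, 1 / (k:ℝ) * a k) / H n) atTop (𝓝 c) := by
  have hl : (fun i : ℕ => 1 / ((i:ℝ)+1) * (a (i+1) - c)) =o[atTop] (fun i : ℕ => 1 / ((i:ℝ)+1)) := by
    have h0 : (fun i : ℕ => a (i+1) - c) =o[atTop] (fun _ => (1:ℝ)) := by
      rw [Asymptotics.isLittleO_one_iff]
      have := (ha.comp (tendsto_add_atTop_nat 1)).sub_const c
      simpa using this
    have := (Asymptotics.isBigO_refl (fun i : ℕ => 1 / ((i:ℝ)+1)) atTop).mul_isLittleO h0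
    simpa using this
  have h2 := hl.sum_range (fun i => by positivity) Real.tendsto_sum_range_one_div_nat_succ_atTop
  have h3 := h2.tendsto_div_nhds_zero
  have h4 := h3.add_const c
  rw [zero_add] at h4
  refine h4.congr' ?_
  filter_upwards [eventually_ge_atTop 1] with n hn
  have hp := H_pos hn
  rw [← H_range]
  have e : ∑ k ∈ Finset.Icc 1 n, 1 / (k:ℝ) * a k = ∑ i ∈ Finset.range n, 1 / ((i:ℝ)+1) * a (i+1) := by
    clear hp hn
    induction n with
    | zero => simp
    | succ n ih => rw [Finset.sum_Icc_succ_top (by omega), Finset.sum_range_succ, ih]; push_cast; rfl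
  rw [e]
  simp_rw [mul_sub]
  rw [Finset.sum_sub_distrib, ← Finset.sum_mul, ← H_range]
  field_simp
  ring

lemma ae_conv {Ω : Type*} [MeasurableSpace Ω] (μ : Measure Ω) [IsProbabilityMeasure μ]
    (Y : ℕ → Ω → ℝ) (hY0 : ∀ k x, 0 ≤ Y k x) (hY : ∀ k, MemLp (Y k) 2 μ)
    (c : ℝ) (hc : Tendsto (fun k => ∫ x, Y k x ∂μ) atTop (𝓝 c)) (C : ℝ)
    (hvar : ∀ n : ℕ, 1 ≤ n → ∫ x, ((∑ k ∈ Finset.Icc 1 n, 1 / (k:ℝ) * Y k x) / H n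
      - ∫ y, (∑ k ∈ Finset.Icc 1 n, 1 / (k:ℝ) * Y k y) / H n ∂μ)^2 ∂μ ≤ C / H n) :
    ∀ᵐ x ∂μ, Tendsto (fun n : ℕ => (∑ k ∈ Finset.Icc 1 n, 1 / (k:ℝ) * Y k x) / H n) atTop (𝓝 c) := by
  choose N hN using exists_seq
  set X : ℕ → Ω → ℝ := fun n x => (∑ k ∈ Finset.Icc 1 n, 1 / (k:ℝ) * Y k x) / H n with hX
  have hXm : ∀ n, MemLp (X n) 2 μ := by
    intro n
    have : MemLp (fun x => ∑ k ∈ Finset.Icc 1 n, 1 / (k:ℝ) * Y k x) 2 μ :=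
      memLp_finsetSum _ (fun k _ => (hY k).const_mul _)
    simpa [hX, div_eq_inv_mul] using this.const_mul (H n)⁻¹
  have hYi : ∀ k, Integrable (Y k) μ := fun k => (hY k).integrable (by norm_num)
  have hE : Tendsto (fun n => ∫ x, X n x ∂μ) atTop (𝓝 c) := by
    refine (log_cesaro _ _ hc).congr fun n => ?_
    simp only [hX]
    rw [integral_div, integral_finsetSum _ (fun k _ => (hYi k).const_mul _)]
    simp_rw [integral_const_mul]
  have hNt : Tendsto N atTop atTop := by
    rw [tendsto_atTop]
    intro b
    have h1 : Tendsto (fun k : ℕ => (k:ℝ)^2) atTop atTop :=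
      (tendsto_pow_atTop (by norm_num)).comp tendsto_natCast_atTop_atTop
    filter_upwards [h1.eventually_gt_atTop (H b)] with k hk
    by_contra hlt
    have := H_mono (le_of_not_ge hlt)
    linarith [(hN k).1]
  set Z : ℕ → Ω → ℝ := fun k x => X (N (k+1)) x - ∫ y, X (N (k+1)) y ∂μ with hZ
  have hZm : ∀ k, MemLp (Z k) 2 μ := fun k => (hXm _).sub (memLp_const _)
  have hZi : ∀ k, Integrable (fun x => (Z k x)^2) μ := fun k => (hZm k).integrable_sq
  have hC0 : 0 ≤ C := by
    have := (integral_nonneg (fun x => sq_nonneg _)).trans (hvar 1 le_rfl)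
    simpa [H] using this
  have hZb : ∀ k, ∫ x, (Z k x)^2 ∂μ ≤ C * (1 / ((k+1:ℕ):ℝ)^2) := by
    intro k
    have h1 : 1 ≤ N (k+1) := by
      by_contra hlt
      have h0 : N (k+1) = 0 := by omega
      have := (hN (k+1)).1
      rw [h0, H_zero] at this
      have : (0:ℝ) < ((k+1:ℕ):ℝ)^2 := by positivity
      linarith
    refine (hvar _ h1).trans ?_
    rw [mul_one_div]
    have := (hN (k+1)).1
    gcongr
  have hsum : Summable (fun k : ℕ => C * (1 / ((k+1:ℕ):ℝ)^2)) := by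
    have h0 : Summable (fun k : ℕ => (1 / ((k:ℕ):ℝ)^2)) := Real.summable_one_div_nat_pow.2 (by norm_num)
    exact ((summable_nat_add_iff 1).2 h0).mul_left C
  have hfin : ∫⁻ x, ∑' k, ENNReal.ofReal ((Z k x)^2) ∂μ ≠ ⊤ := by
    rw [lintegral_tsum (fun k => ((hZi k).aestronglyMeasurable.aemeasurable.ennreal_ofReal))]
    refine ne_top_of_le_ne_top hsum.tsum_ofReal_ne_top (ENNReal.tsum_le_tsum fun k => ?_)
    rw [← ofReal_integral_eq_lintegral_ofReal (hZi k) (Eventually.of_forall fun x => sq_nonneg _)]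
    exact ENNReal.ofReal_le_ofReal (hZb k)
  have hae := ae_lt_top' (AEMeasurable.tsum
    (fun k => ((hZi k).aestronglyMeasurable.aemeasurable.ennreal_ofReal))) hfin
  filter_upwards [hae] with x hx
  have t0 := ENNReal.tendsto_atTop_zero_of_tsum_ne_top hx.ne
  have t1 : Tendsto (fun k => (Z k x)^2) atTop (𝓝 0) := by
    have := (ENNReal.tendsto_toReal ENNReal.zero_ne_top).comp t0
    simpa [Function.comp_def, ENNReal.toReal_ofReal (sq_nonneg _)] using this
  have t2 : Tendsto (fun k => Z k x) atTop (𝓝 0) := by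
    have := (Real.continuous_sqrt.tendsto 0).comp t1
    simp only [Function.comp_def, Real.sqrt_sq_eq_abs, Real.sqrt_zero] at this
    exact (tendsto_zero_iff_abs_tendsto_zero _).2 this
  have t3 : Tendsto (fun k => X (N (k+1)) x) atTop (𝓝 c) := by
    have := t2.add (hE.comp (hNt.comp (tendsto_add_atTop_nat 1)))
    simpa [hZ, Function.comp_def] using this
  have t4 : Tendsto (fun k => X (N k) x) atTop (𝓝 c) := (tendsto_add_atTop_iff_nat 1).1 t3
  refine interp N hN (fun n => ∑ k ∈ Finset.Icc 1 n, 1 / (k:ℝ) * Y k x) ?_ ?_ c t4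
  · refine monotone_nat_of_le_succ fun n => ?_
    rw [Finset.sum_Icc_succ_top (by omega)]
    have := hY0 (n+1) x
    have : 0 ≤ 1 / ((n+1:ℕ):ℝ) * Y (n+1) x := by positivity
    linarith
  · intro n
    exact Finset.sum_nonneg fun k _ => mul_nonneg (by positivity) (hY0 k x)

end ASCLT

namespace ASCLT

/-- ramp functions -/
noncomputable def ramp (p i : ℕ) (x : ℝ) : ℝ :=
  max 0 (min 1 (x * (p+1) + ((p:ℝ)+1)^2 + 1 - i))

/-- tail function -/
noncomputable def tailf (p : ℕ) (x : ℝ) : ℝ := max 0 (2 * |x| - (p+1))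

lemma ramp_lip (p i : ℕ) : LipschitzWith ((p:NNReal)+1) (ramp p i) := by
  have h1 : LipschitzWith ((p:NNReal)+1) (fun x : ℝ => x * (p+1) + ((p:ℝ)+1)^2 + 1 - i) := by
    refine LipschitzWith.of_dist_le_mul fun x y => ?_
    rw [Real.dist_eq, Real.dist_eq]
    push_cast
    rw [← abs_of_nonneg (show (0:ℝ) ≤ p+1 by positivity), ← abs_mul,
      abs_of_nonneg (show (0:ℝ) ≤ p+1 by positivity)]
    apply le_of_eq; congr 1; ring
  exact (h1.const_min 1).const_max 0

lemma ramp_nonneg (p i : ℕ) (x : ℝ) : 0 ≤ ramp p i x := le_max_left _ _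

lemma tailf_lip (p : ℕ) : LipschitzWith 2 (tailf p) := by
  have h1 : LipschitzWith 2 (fun x : ℝ => 2 * |x| - (p+1)) := by
    refine LipschitzWith.of_dist_le_mul fun x y => ?_
    rw [Real.dist_eq, Real.dist_eq]
    have := abs_abs_sub_abs_le x y
    rw [show 2 * |x| - (p+1) - (2 * |y| - ((p:ℝ)+1)) = 2 * (|x| - |y|) by ring, abs_mul]
    simp; exact this
  exact h1.const_max 0

lemma tailf_nonneg (p : ℕ) (x : ℝ) : 0 ≤ tailf p x := le_max_left _ _

/-- nodes -/
noncomputable def node (p i : ℕ) : ℝ := ((i:ℝ) - ((p:ℝ)+1)^2 - 1) / (p+1)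

lemma approx (p : ℕ) (g : ℝ → ℝ) (hg : LipschitzWith 1 g) (hg0 : g 0 = 0) (x : ℝ) :
    |g x - ∑ i ∈ Finset.range (2*(p+1)^2+1), g (node p i) * (ramp p i x - ramp p (i+1) x)|
      ≤ 2 / ((p:ℝ)+1) + tailf p x := by
  set M := 2*(p+1)^2+1 with hM
  have hq : (0:ℝ) < p + 1 := by positivity
  have hgl : ∀ a b, |g a - g b| ≤ |a - b| := fun a b => by
    have := hg.dist_le_mul a b
    simpa [Real.dist_eq] using this
  have htel : ∑ i ∈ Finset.range M, (ramp p i x - ramp p (i+1) x) = ramp p 0 x - ramp p M x := by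
    rw [Finset.sum_range_sub']
  have hφ0 : ∀ i, 0 ≤ ramp p i x - ramp p (i+1) x := fun i => by
    rw [sub_nonneg]; unfold ramp; push_cast
    exact max_le_max le_rfl (min_le_min le_rfl (by linarith))
  have hsupp : ∀ i, |g x - g (node p i)| * (ramp p i x - ramp p (i+1) x)
      ≤ 2 / ((p:ℝ)+1) * (ramp p i x - ramp p (i+1) x) := by
    intro i
    set y : ℝ := x * (p+1) + ((p:ℝ)+1)^2 + 1 - i with hy
    have hr1 : ramp p i x = max 0 (min 1 y) := rfl
    have hr2 : ramp p (i+1) x = max 0 (min 1 (y - 1)) := by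
      unfold ramp; rw [hy]; push_cast; congr 2; ring
    by_cases hyy : 0 ≤ y ∧ y ≤ 2
    · refine mul_le_mul_of_nonneg_right ((hgl _ _).trans ?_) (hφ0 i)
      have : x - node p i = y / (p+1) := by
        unfold node; rw [hy]; field_simp; ring
      rw [this, abs_of_nonneg (div_nonneg hyy.1 hq.le)]
      exact div_le_div_of_nonneg_right hyy.2 hq.le
    · have hz : ramp p i x - ramp p (i+1) x = 0 := by
        rw [hr1, hr2]
        by_cases h0 : 0 ≤ y
        · have h2 : 2 < y := by by_contra h; exact hyy ⟨h0, not_lt.1 h⟩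
          rw [min_eq_left (by linarith), min_eq_left (by linarith), sub_self]
        · push Not at h0
          rw [max_eq_left ((min_le_right _ _).trans h0.le),
            max_eq_left ((min_le_right _ _).trans (by linarith)), sub_self]
      rw [hz]; simp
  have hr0 : ∀ i, ramp p i x ≤ 1 := fun i => max_le zero_le_one (min_le_left _ _)
  set χ := ramp p 0 x - ramp p M x with hχ
  have hχ1 : χ ≤ 1 := by linarith [hr0 0, ramp_nonneg p M x]
  have hχ0 : 0 ≤ χ := by rw [← htel]; exact Finset.sum_nonneg fun i _ => hφ0 i
  have htail : (1 - χ) * |x| ≤ tailf p x := by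
    by_cases hx : |x| ≤ p + 1
    · have hx' := abs_le.1 hx
      have e0 : ramp p 0 x = 1 := by
        unfold ramp
        rw [min_eq_left, max_eq_right zero_le_one]
        push_cast
        nlinarith
      have e1 : ramp p M x = 0 := by
        unfold ramp
        rw [max_eq_left]
        refine (min_le_right _ _).trans ?_
        rw [hM]; push_cast
        nlinarith
      rw [hχ, e0, e1]
      simp [tailf_nonneg]
    · push Not at hx
      have : |x| ≤ tailf p x := le_trans (by linarith) (le_max_right _ _)
      refine le_trans ?_ this
      nlinarith [abs_nonneg x]
  have hdec : g x - ∑ i ∈ Finset.range M, g (node p i) * (ramp p i x - ramp p (i+1) x)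
      = ∑ i ∈ Finset.range M, (g x - g (node p i)) * (ramp p i x - ramp p (i+1) x)
        + (1 - χ) * g x := by
    simp_rw [sub_mul (g x)]
    rw [Finset.sum_sub_distrib, ← Finset.mul_sum, htel]; ring
  rw [hdec]
  refine (abs_add_le _ _).trans (add_le_add ?_ ?_)
  · refine (Finset.abs_sum_le_sum_abs _ _).trans ?_
    calc _ ≤ ∑ i ∈ Finset.range M, 2 / ((p:ℝ)+1) * (ramp p i x - ramp p (i+1) x) := by
          refine Finset.sum_le_sum fun i _ => ?_
          rw [abs_mul, abs_of_nonneg (hφ0 i)]; exact hsupp i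
      _ = 2 / ((p:ℝ)+1) * χ := by rw [← Finset.mul_sum, htel]
      _ ≤ _ := mul_le_of_le_one_right (by positivity) hχ1
  · rw [abs_mul, abs_of_nonneg (by linarith)]
    have := hgl x 0
    rw [hg0, sub_zero, sub_zero] at this
    exact (mul_le_mul_of_nonneg_left this (by linarith)).trans htail

/-- upper bound for the Kantorovich distance -/
noncomputable def kb (ν Q : Measure ℝ) (p : ℕ) : ℝ :=
  (∑ i ∈ Finset.range (2*(p+1)^2+1), |node p i| *
    |((∫ x, ramp p i x ∂ν) - ∫ x, ramp p (i+1) x ∂ν)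
      - ((∫ x, ramp p i x ∂Q) - ∫ x, ramp p (i+1) x ∂Q)|)
  + 4 / ((p:ℝ)+1) + (∫ x, tailf p x ∂ν) + ∫ x, tailf p x ∂Q

lemma half_bound (ν : Measure ℝ) [IsProbabilityMeasure ν] (hi : Integrable (fun x : ℝ => x) ν)
    (p : ℕ) (g : ℝ → ℝ) (hg : LipschitzWith 1 g) (hg0 : g 0 = 0) :
    |(∫ x, g x ∂ν) - ∑ i ∈ Finset.range (2*(p+1)^2+1),
      g (node p i) * ((∫ x, ramp p i x ∂ν) - ∫ x, ramp p (i+1) x ∂ν)|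
      ≤ 2 / ((p:ℝ)+1) + ∫ x, tailf p x ∂ν := by
  have hr : ∀ i, Integrable (ramp p i) ν := fun i => lip_integrable hi (ramp_lip p i)
  have ht : Integrable (tailf p) ν := lip_integrable hi (tailf_lip p)
  have hgi : Integrable g ν := lip_integrable hi hg
  have hs : ∀ i ∈ Finset.range (2*(p+1)^2+1),
      Integrable (fun x => g (node p i) * (ramp p i x - ramp p (i+1) x)) ν := fun i _ =>
    ((hr i).sub (hr (i+1))).const_mul _
  have e : ∑ i ∈ Finset.range (2*(p+1)^2+1),
      g (node p i) * ((∫ x, ramp p i x ∂ν) - ∫ x, ramp p (i+1) x ∂ν)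
      = ∫ x, ∑ i ∈ Finset.range (2*(p+1)^2+1), g (node p i) * (ramp p i x - ramp p (i+1) x) ∂ν := by
    rw [integral_finsetSum _ hs]
    refine Finset.sum_congr rfl fun i _ => ?_
    rw [integral_const_mul, integral_sub (hr i) (hr (i+1))]
  rw [e, ← integral_sub hgi (integrable_finsetSum _ hs)]
  refine abs_integral_le_integral_abs.trans ?_
  refine (integral_mono (hgi.sub (integrable_finsetSum _ hs)).abs
    ((integrable_const (2 / ((p:ℝ)+1))).add ht) (fun x => approx p g hg hg0 x)).trans ?_
  have := integral_add (integrable_const (μ := ν) (2 / ((p:ℝ)+1))) ht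
  simp only [integral_const, probReal_univ, smul_eq_mul, one_mul] at this
  exact this.le

lemma kd_le (ν Q : Measure ℝ) [IsProbabilityMeasure ν] [IsProbabilityMeasure Q]
    (hi : Integrable (fun x : ℝ => x) ν) (hiQ : Integrable (fun x : ℝ => x) Q) (p : ℕ) :
    0 ≤ kantorovichDist ν Q ∧ kantorovichDist ν Q ≤ kb ν Q p := by
  have main : ∀ r ∈ {r : ℝ | ∃ g : ℝ → ℝ, LipschitzWith 1 g ∧
    r = (∫ ξ, g ξ ∂ν) - (∫ ξ, g ξ ∂Q)}, r ≤ kb ν Q p := by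
    rintro r ⟨g, hg, rfl⟩
    set f : ℝ → ℝ := fun x => g x - g 0 with hf
    have hfl : LipschitzWith 1 f := by
      refine LipschitzWith.of_dist_le_mul fun x y => ?_
      have := hg.dist_le_mul x y
      simpa [hf, Real.dist_eq] using this
    have hf0 : f 0 = 0 := by simp [hf]
    have eν : ∫ x, f x ∂ν = (∫ x, g x ∂ν) - g 0 := by
      simp only [hf]
      rw [integral_sub (lip_integrable hi hg) (integrable_const _)]; simp
    have eQ : ∫ x, f x ∂Q = (∫ x, g x ∂Q) - g 0 := by
      simp only [hf]
      rw [integral_sub (lip_integrable hiQ hg) (integrable_const _)]; simp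
    have h1 := (abs_le.1 (half_bound ν hi p f hfl hf0)).2
    have h2 := (abs_le.1 (half_bound Q hiQ p f hfl hf0)).1
    have h3 : (∑ i ∈ Finset.range (2*(p+1)^2+1),
      f (node p i) * ((∫ x, ramp p i x ∂ν) - ∫ x, ramp p (i+1) x ∂ν)) -
      (∑ i ∈ Finset.range (2*(p+1)^2+1),
      f (node p i) * ((∫ x, ramp p i x ∂Q) - ∫ x, ramp p (i+1) x ∂Q)) ≤
      (∑ i ∈ Finset.range (2*(p+1)^2+1), |node p i| *
        |((∫ x, ramp p i x ∂ν) - ∫ x, ramp p (i+1) x ∂ν)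
        - ((∫ x, ramp p i x ∂Q) - ∫ x, ramp p (i+1) x ∂Q)|) := by
      rw [← Finset.sum_sub_distrib]
      refine Finset.sum_le_sum fun i _ => ?_
      rw [← mul_sub]
      refine (le_abs_self _).trans ?_
      rw [abs_mul]
      refine mul_le_mul_of_nonneg_right ?_ (abs_nonneg _)
      have := hfl.dist_le_mul (node p i) 0
      simpa [Real.dist_eq, hf0] using this
    unfold kb
    have h4 : 4 / ((p:ℝ)+1) = 2 / ((p:ℝ)+1) + 2 / ((p:ℝ)+1) := by ring
    rw [h4]
    linarith
  have hne : (0:ℝ) ∈ {r : ℝ | ∃ g : ℝ → ℝ, LipschitzWith 1 g ∧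
    r = (∫ ξ, g ξ ∂ν) - (∫ ξ, g ξ ∂Q)} :=
    ⟨fun _ => 0, (LipschitzWith.const (0:ℝ)).weaken zero_le_one, by simp⟩
  exact ⟨le_csSup ⟨_, main⟩ hne, csSup_le ⟨0, hne⟩ main⟩

lemma kd_tendsto (ν : ℕ → Measure ℝ) (Q : Measure ℝ) [IsProbabilityMeasure Q]
    (hν : ∀ᶠ n in atTop, IsProbabilityMeasure (ν n) ∧ Integrable (fun x : ℝ => x) (ν n))
    (hiQ : Integrable (fun x : ℝ => x) Q)
    (hr : ∀ p i, Tendsto (fun n => ∫ x, ramp p i x ∂(ν n)) atTop (𝓝 (∫ x, ramp p i x ∂Q)))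
    (ht : ∀ p, Tendsto (fun n => ∫ x, tailf p x ∂(ν n)) atTop (𝓝 (∫ x, tailf p x ∂Q))) :
    Tendsto (fun n => kantorovichDist (ν n) Q) atTop (𝓝 0) := by
  have hkb : ∀ p, Tendsto (fun n => kb (ν n) Q p) atTop
      (𝓝 (4 / ((p:ℝ)+1) + 2 * ∫ x, tailf p x ∂Q)) := by
    intro p
    have h1 : Tendsto (fun n => ∑ i ∈ Finset.range (2*(p+1)^2+1), |node p i| *
      |((∫ x, ramp p i x ∂(ν n)) - ∫ x, ramp p (i+1) x ∂(ν n))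
      - ((∫ x, ramp p i x ∂Q) - ∫ x, ramp p (i+1) x ∂Q)|) atTop
        (𝓝 (∑ i ∈ Finset.range (2*(p+1)^2+1), |node p i| *
      |((∫ x, ramp p i x ∂Q) - ∫ x, ramp p (i+1) x ∂Q)
      - ((∫ x, ramp p i x ∂Q) - ∫ x, ramp p (i+1) x ∂Q)|)) :=
      tendsto_finsetSum _ fun i _ =>
        ((((hr p i).sub (hr p (i+1))).sub_const _).abs).const_mul _
    have h2 := ((h1.add_const (4 / ((p:ℝ)+1))).add (ht p)).add_const (∫ x, tailf p x ∂Q)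
    simp only [sub_self, abs_zero, mul_zero, Finset.sum_const_zero] at h2
    rw [show 4 / ((p:ℝ)+1) + 2 * ∫ x, tailf p x ∂Q
      = 0 + 4 / ((p:ℝ)+1) + (∫ x, tailf p x ∂Q) + ∫ x, tailf p x ∂Q by ring]
    exact h2
  have hlim : Tendsto (fun p : ℕ => 4 / ((p:ℝ)+1) + 2 * ∫ x, tailf p x ∂Q) atTop (𝓝 0) := by
    have a1 : Tendsto (fun p : ℕ => 4 / ((p:ℝ)+1)) atTop (𝓝 0) := by
      have := (tendsto_one_div_add_atTop_nhds_zero_nat (𝕜 := ℝ)).const_mul 4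
      simpa [div_eq_mul_inv] using this
    have a2 : Tendsto (fun p : ℕ => ∫ x, tailf p x ∂Q) atTop (𝓝 (∫ x : ℝ, (0:ℝ) ∂Q)) := by
      refine tendsto_integral_of_dominated_convergence (fun x => 2 * |x|)
        (fun p => (tailf_lip p).continuous.aestronglyMeasurable) (hiQ.abs.const_mul 2) ?_ ?_
      · intro p
        refine Eventually.of_forall fun x => ?_
        rw [Real.norm_eq_abs, abs_of_nonneg (tailf_nonneg p x)]
        refine max_le (by positivity) ?_
        have : (0:ℝ) ≤ p := by positivity
        linarith
      · refine Eventually.of_forall fun x => ?_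
        refine tendsto_const_nhds.congr' ?_
        filter_upwards [tendsto_natCast_atTop_atTop.eventually_ge_atTop (2 * |x|)] with p hp
        unfold tailf
        rw [max_eq_left]; linarith
    have := a1.add (a2.const_mul 2)
    simpa using this
  rw [Metric.tendsto_atTop]
  intro ε hε
  obtain ⟨p, hp⟩ := (hlim.eventually (gt_mem_nhds hε)).exists
  have hev := (hkb p).eventually (gt_mem_nhds hp)
  obtain ⟨N, hN⟩ := eventually_atTop.1 (hev.and hν)
  refine ⟨N, fun n hn => ?_⟩
  obtain ⟨h1, h2, h3⟩ := hN n hn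
  have := kd_le (ν n) Q h3 hiQ p
  rw [Real.dist_eq, sub_zero, abs_of_nonneg this.1]
  exact this.2.trans_lt h1

lemma sum_pow_bound (m n : ℕ) (hm : 1 ≤ m) (hmn : m ≤ n) :
    ∑ k ∈ Finset.Icc m n, 1 / ((k:ℝ) * Real.sqrt k) ≤ 3 / Real.sqrt m - 2 / Real.sqrt n := by
  induction n, hmn using Nat.le_induction with
  | base =>
    simp only [Finset.Icc_self, Finset.sum_singleton]
    have h1 : (1:ℝ) ≤ m := by exact_mod_cast hm
    have h2 : 0 < Real.sqrt m := Real.sqrt_pos.2 (by linarith)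
    rw [← sub_div, show (3:ℝ)-2 = 1 by norm_num]
    refine one_div_le_one_div_of_le h2 ?_
    nlinarith
  | succ n hmn ih =>
    rw [Finset.sum_Icc_succ_top (by omega)]
    have h1 : (1:ℝ) ≤ n := by exact_mod_cast hm.trans hmn
    set a := Real.sqrt n with ha
    set b := Real.sqrt ((n+1:ℕ):ℝ) with hb
    have ha2 : a^2 = n := Real.sq_sqrt (by linarith)
    have hb2 : b^2 = n + 1 := by rw [hb, Real.sq_sqrt (by positivity)]; push_cast; rfl
    have hap : 0 < a := Real.sqrt_pos.2 (by linarith)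
    have hbp : 0 < b := Real.sqrt_pos.2 (by positivity)
    have hab : a ≤ b := Real.sqrt_le_sqrt (by push_cast; linarith)
    have key : 1 / (((n+1:ℕ):ℝ) * b) ≤ 2 / a - 2 / b := by
      have e : ((n+1:ℕ):ℝ) = b^2 := by rw [hb2]; push_cast; rfl
      rw [e, div_sub_div _ _ hap.ne' hbp.ne', div_le_div_iff₀ (by positivity) (by positivity)]
      -- 1 * (a*b) ≤ (2 b - a*2) * (b^2*b)
      have h3 : (b - a) * (b + a) = 1 := by nlinarith
      have h4 : 1 ≤ (b - a) * (2 * b) := by nlinarith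
      have h7 : a * b ≤ b^2 := by nlinarith
      calc 1 * (a*b) ≤ 1 * b^2 := by linarith
        _ ≤ ((b - a) * (2 * b)) * b^2 := by gcongr
        _ = _ := by ring
    linarith

end ASCLT

namespace ASCLT

/-- extension of a finite vector -/
noncomputable def zext (n : ℕ) (z : Fin n → ℝ) (j : ℕ) : ℝ := if h : j < n then z ⟨j, h⟩ else 0

lemma zext_orbit (T : ℝ → ℝ) (v : ℝ → ℝ) (n k : ℕ) (hk : k ≤ n) (x : ℝ) :
    ∑ j ∈ Finset.range k, v (zext n (fun i => T^[(i:ℕ)] x) j)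
      = ∑ j ∈ Finset.range k, v (T^[j] x) := by
  refine Finset.sum_congr rfl fun j hj => ?_
  rw [Finset.mem_range] at hj
  unfold zext
  rw [dif_pos (by omega)]

lemma zext_diff (v : ℝ → ℝ) (Lv : NNReal) (hv : LipschitzWith Lv v) (n k : ℕ) (j : Fin n)
    (z zz : Fin n → ℝ) (hz : ∀ i, i ≠ j → z i = zz i) :
    |(∑ i ∈ Finset.range k, v (zext n z i)) - ∑ i ∈ Finset.range k, v (zext n zz i)|
      ≤ if (j:ℕ) < k then Lv * |z j - zz j| else 0 := by
  have hne : ∀ i, i ≠ (j:ℕ) → zext n z i = zext n zz i := by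
    intro i hi
    unfold zext
    split_ifs with h
    · exact hz _ (fun h' => hi (by rw [← h']))
    · rfl
  have hj : ∀ w : Fin n → ℝ, zext n w j = w j := fun w => by simp [zext]
  rw [← Finset.sum_sub_distrib]
  split_ifs with h
  · rw [Finset.sum_eq_single (j:ℕ)]
    · rw [hj, hj]
      have := hv.dist_le_mul (z j) (zz j)
      simpa [Real.dist_eq] using this
    · intro i _ hi
      rw [hne i hi, sub_self]
    · intro h'; exact absurd (Finset.mem_range.2 h) h'
  · rw [Finset.sum_eq_zero]
    · simp
    · intro i hi
      rw [hne i (by rw [Finset.mem_range] at hi; omega), sub_self]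

lemma orb_var (T : ℝ → ℝ) (μ : Measure ℝ) (D : ℝ) (hD : 0 < D)
    (hvar : ∀ n : ℕ, 1 ≤ n → ∀ (K : (Fin n → ℝ) → ℝ) (L : Fin n → ℝ),
      (∀ (j : Fin n) (z zz : Fin n → ℝ), (∀ i, i ≠ j → z i = zz i) →
        |K z - K zz| ≤ L j * |z j - zz j|) →
      ∫ x, (K (fun i => T^[(i:ℕ)] x) - ∫ y, K (fun i => T^[(i:ℕ)] y) ∂μ) ^ 2 ∂μ
        ≤ D * ∑ j, (L j) ^ 2)
    (v : ℝ → ℝ) (Lv : NNReal) (hv : LipschitzWith Lv v)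
    (f : ℝ → ℝ) (L : NNReal) (hf : LipschitzWith L f) (n : ℕ) (hn : 1 ≤ n) :
    ∫ x, ((∑ k ∈ Finset.Icc 1 n, 1 / (k:ℝ) *
        f ((∑ j ∈ Finset.range k, v (T^[j] x)) / Real.sqrt k)) / H n
      - ∫ y, (∑ k ∈ Finset.Icc 1 n, 1 / (k:ℝ) *
        f ((∑ j ∈ Finset.range k, v (T^[j] y)) / Real.sqrt k)) / H n ∂μ)^2 ∂μ
      ≤ (D * (9 * L^2 * Lv^2)) / H n := by
  have hH := H_pos hn
  set K : (Fin n → ℝ) → ℝ := fun z => (∑ k ∈ Finset.Icc 1 n, 1 / (k:ℝ) *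
        f ((∑ j ∈ Finset.range k, v (zext n z j)) / Real.sqrt k)) / H n with hK
  have hKo : ∀ x, K (fun i => T^[(i:ℕ)] x) = (∑ k ∈ Finset.Icc 1 n, 1 / (k:ℝ) *
        f ((∑ j ∈ Finset.range k, v (T^[j] x)) / Real.sqrt k)) / H n := by
    intro x
    simp only [hK]
    congr 1
    refine Finset.sum_congr rfl fun k hk => ?_
    rw [zext_orbit T v n k (Finset.mem_Icc.1 hk).2]
  have hmain := hvar n hn K (fun j => 3 * L * Lv / (H n * Real.sqrt ((j:ℕ)+1))) ?_
  · simp_rw [hKo] at hmain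
    refine hmain.trans (le_of_eq ?_)
    rw [mul_div_assoc]
    congr 1
    have : ∀ j : Fin n, (3 * (L:ℝ) * Lv / (H n * Real.sqrt ((j:ℕ)+1)))^2
        = (9 * L^2 * Lv^2 / (H n)^2) * (1 / ((j:ℕ)+1)) := by
      intro j
      rw [div_pow, mul_pow (H n), Real.sq_sqrt (by positivity)]
      field_simp; ring
    simp_rw [this]
    rw [← Finset.mul_sum, Fin.sum_univ_eq_sum_range (fun j : ℕ => 1 / ((j:ℝ)+1)) n, ← H_range]
    field_simp
  · intro j z zz hz
    set d := |z j - zz j| with hd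
    have hd0 : 0 ≤ d := abs_nonneg _
    simp only [hK]
    rw [← sub_div, ← Finset.sum_sub_distrib, abs_div, abs_of_pos hH, div_le_iff₀ hH]
    have hstep : ∀ k ∈ Finset.Icc 1 n,
        |1 / (k:ℝ) * f ((∑ j ∈ Finset.range k, v (zext n z j)) / Real.sqrt k)
        - 1 / (k:ℝ) * f ((∑ j ∈ Finset.range k, v (zext n zz j)) / Real.sqrt k)|
        ≤ if (j:ℕ)+1 ≤ k then (L * Lv * d) * (1 / ((k:ℝ) * Real.sqrt k)) else 0 := by
      intro k hk
      have hk1 : (1:ℝ) ≤ k := by exact_mod_cast (Finset.mem_Icc.1 hk).1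
      have hs : 0 < Real.sqrt k := Real.sqrt_pos.2 (by linarith)
      have h1 := zext_diff v Lv hv n k j z zz hz
      have h2 := hf.dist_le_mul ((∑ j ∈ Finset.range k, v (zext n z j)) / Real.sqrt k)
        ((∑ j ∈ Finset.range k, v (zext n zz j)) / Real.sqrt k)
      rw [Real.dist_eq, Real.dist_eq, ← sub_div, abs_div, abs_of_pos hs] at h2
      rw [← mul_sub, abs_mul, abs_of_nonneg (show (0:ℝ) ≤ 1 / k by positivity)]
      calc _ ≤ 1 / (k:ℝ) * (L * (|(∑ i ∈ Finset.range k, v (zext n z i))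
                - ∑ i ∈ Finset.range k, v (zext n zz i)| / Real.sqrt k)) := by gcongr
        _ ≤ 1 / (k:ℝ) * (L * ((if (j:ℕ) < k then Lv * d else 0) / Real.sqrt k)) := by gcongr
        _ = _ := by
          by_cases hjk : (j:ℕ) < k
          · rw [if_pos hjk, if_pos (by omega)]; field_simp
          · rw [if_neg hjk, if_neg (by omega)]; simp
    refine (Finset.abs_sum_le_sum_abs _ _).trans ((Finset.sum_le_sum hstep).trans ?_)
    rw [← Finset.sum_filter]
    have hfil : (Finset.Icc 1 n).filter (fun k => (j:ℕ)+1 ≤ k) = Finset.Icc ((j:ℕ)+1) n := by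
      ext k; simp only [Finset.mem_filter, Finset.mem_Icc]; omega
    rw [hfil, ← Finset.mul_sum]
    have hb := sum_pow_bound ((j:ℕ)+1) n (by omega) (by have := j.2; omega)
    push_cast at hb
    have hpos : 0 ≤ 2 / Real.sqrt (n:ℝ) := by positivity
    calc _ ≤ (L * Lv * d) * (3 / Real.sqrt ((j:ℕ)+1)) := by
          gcongr; linarith
      _ = _ := by field_simp

lemma cdf_gauss (σ2 : ℝ) (hσ : 0 < σ2) (t : ℝ) :
    (ProbabilityTheory.gaussianReal 0 σ2.toNNReal).real (Iic t)
     = (Real.sqrt (2 * Real.pi))⁻¹ * ∫ ξ in Iic (t / Real.sqrt σ2), Real.exp (-ξ ^ 2 / 2) := by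
  have hs : 0 < Real.sqrt σ2 := Real.sqrt_pos.2 hσ
  have e : ProbabilityTheory.gaussianReal 0 σ2.toNNReal
      = (ProbabilityTheory.gaussianReal 0 1).map (Real.sqrt σ2 * ·) := by
    rw [ProbabilityTheory.gaussianReal_map_const_mul]
    congr 1
    · simp
    · ext; simp [Real.sq_sqrt hσ.le, hσ.le]
  rw [e, map_measureReal_apply (by fun_prop) measurableSet_Iic]
  have : (Real.sqrt σ2 * ·) ⁻¹' (Iic t) = Iic (t / Real.sqrt σ2) := by
    ext x; simp only [mem_preimage, mem_Iic]; rw [le_div_iff₀ hs, mul_comm]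
  rw [this, measureReal_def, ProbabilityTheory.gaussianReal_apply_eq_integral _ one_ne_zero,
    ENNReal.toReal_ofReal (integral_nonneg fun x => ProbabilityTheory.gaussianPDFReal_nonneg _ _ _)]
  rw [← integral_const_mul]
  refine integral_congr_ae (Eventually.of_forall fun x => ?_)
  simp [ProbabilityTheory.gaussianPDFReal]

lemma integral_we (T v : ℝ → ℝ) (n : ℕ) (x : ℝ) (hn : 1 ≤ n) (f : ℝ → ℝ) :
    ∫ y, f y ∂(weightedEmpirical T v n x) = (∑ k ∈ Finset.Icc 1 n, 1 / (k:ℝ) *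
        f ((∑ j ∈ Finset.range k, v (T^[j] x)) / Real.sqrt k)) / H n := by
  unfold weightedEmpirical
  rw [integral_smul_measure, integral_finsetSum_measure]
  · change (ENNReal.ofReal (H n))⁻¹.toReal • _ = _
    rw [ENNReal.toReal_inv, ENNReal.toReal_ofReal (H_pos hn).le, smul_eq_mul, div_eq_inv_mul]
    congr 1
    refine Finset.sum_congr rfl fun k hk => ?_
    rw [integral_smul_measure, integral_dirac, ENNReal.toReal_ofReal (by positivity), smul_eq_mul]
  · intro k _
    exact (integrable_dirac (by simp)).smul_measure ENNReal.ofReal_ne_top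

lemma we_prob (T v : ℝ → ℝ) (n : ℕ) (x : ℝ) (hn : 1 ≤ n) :
    IsProbabilityMeasure (weightedEmpirical T v n x) ∧
      Integrable (fun y : ℝ => y) (weightedEmpirical T v n x) := by
  have hH := H_pos hn
  constructor
  · constructor
    unfold weightedEmpirical
    simp only [Measure.smul_apply, Measure.finsetSum_apply, smul_eq_mul, measure_univ, mul_one]
    rw [← ENNReal.ofReal_sum_of_nonneg (fun i _ => by positivity)]
    refine ENNReal.inv_mul_cancel ?_ ENNReal.ofReal_ne_top
    exact (ENNReal.ofReal_pos.2 hH).ne'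
  · unfold weightedEmpirical
    refine Integrable.smul_measure ?_ (ENNReal.inv_ne_top.2 (ENNReal.ofReal_pos.2 hH).ne')
    rw [integrable_finsetSum_measure]
    intro k _
    exact (integrable_dirac (by simp)).smul_measure ENNReal.ofReal_ne_top

lemma main_aux (T : ℝ → ℝ) (hT_maps : MapsTo T (Icc (0:ℝ) 1) (Icc (0:ℝ) 1))
    (μ : Measure ℝ) (hprob : IsProbabilityMeasure μ)
    (hsupp : ∀ᵐ x ∂μ, x ∈ Icc (0:ℝ) 1)
    (hinv : MeasurePreserving T μ μ)
    (D : ℝ) (hD : 0 < D)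
    (hvar : ∀ n : ℕ, 1 ≤ n → ∀ (K : (Fin n → ℝ) → ℝ) (L : Fin n → ℝ),
      (∀ (j : Fin n) (z zz : Fin n → ℝ), (∀ i, i ≠ j → z i = zz i) →
        |K z - K zz| ≤ L j * |z j - zz j|) →
      ∫ x, (K (fun i => T^[(i:ℕ)] x) - ∫ y, K (fun i => T^[(i:ℕ)] y) ∂μ) ^ 2 ∂μ
        ≤ D * ∑ j, (L j) ^ 2)
    (v : ℝ → ℝ) (Lv : NNReal) (hv_lip : LipschitzWith Lv v)
    (hv_mean : ∫ x, v x ∂μ = 0)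
    (σ2 : ℝ) (hσ2_pos : 0 < σ2)
    (hclt : ∀ t : ℝ,
      Tendsto (fun n : ℕ =>
          (μ {x | (∑ j ∈ Finset.range n, v (T^[j] x)) / (Real.sqrt σ2 * Real.sqrt n) ≤ t}).toReal)
        atTop
        (𝓝 ((Real.sqrt (2 * Real.pi))⁻¹ * ∫ ξ in Iic t, Real.exp (-ξ ^ 2 / 2)))) :
    ∀ᵐ x ∂μ, Tendsto
      (fun n : ℕ => kantorovichDist (weightedEmpirical T v n x)
        (ProbabilityTheory.gaussianReal 0 σ2.toNNReal))
      atTop (𝓝 0) := by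
  set Q := ProbabilityTheory.gaussianReal 0 σ2.toNNReal with hQ
  set Z : ℕ → ℝ → ℝ := fun n x => (∑ j ∈ Finset.range n, v (T^[j] x)) / Real.sqrt n with hZ
  have hTm : ∀ j, Measurable (T^[j]) := fun j => hinv.measurable.iterate j
  have hvm : ∀ j, Measurable (fun x => v (T^[j] x)) := fun j =>
    hv_lip.continuous.measurable.comp (hTm j)
  have hZm : ∀ n, Measurable (Z n) := fun n =>
    (Finset.measurable_sum _ fun j _ => hvm j).div_const _
  obtain ⟨B, hB⟩ : ∃ B : ℝ, ∀ x ∈ Icc (0:ℝ) 1, |v x| ≤ B := by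
    obtain ⟨B, hB⟩ := isCompact_Icc.exists_bound_of_continuousOn
      (hv_lip.continuous.continuousOn (s := Icc (0:ℝ) 1))
    exact ⟨B, hB⟩
  have horb : ∀ᵐ x ∂μ, ∀ j, |v (T^[j] x)| ≤ B := by
    filter_upwards [hsupp] with x hx j
    exact hB _ (hT_maps.iterate j hx)
  have hvi : ∀ j, Integrable (fun x => v (T^[j] x)) μ := fun j =>
    Integrable.of_bound (hvm j).aestronglyMeasurable B (by
      filter_upwards [horb] with x hx using hx j)
  have hvz : ∀ j, ∫ x, v (T^[j] x) ∂μ = 0 := by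
    intro j
    have hp := hinv.iterate j
    have : ∫ y, v y ∂(μ.map (T^[j])) = ∫ x, v (T^[j] x) ∂μ :=
      integral_map (hTm j).aemeasurable hv_lip.continuous.aestronglyMeasurable
    rw [← this, hp.map_eq, hv_mean]
  have hZb : ∀ n, ∀ᵐ x ∂μ, |Z n x| ≤ (n * B) / Real.sqrt n := by
    intro n
    filter_upwards [horb] with x hx
    simp only [hZ]
    rw [abs_div, abs_of_nonneg (Real.sqrt_nonneg _)]
    refine div_le_div_of_nonneg_right ?_ (Real.sqrt_nonneg _)
    refine (Finset.abs_sum_le_sum_abs _ _).trans ((Finset.sum_le_sum fun j _ => hx j).trans ?_)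
    simp
  have hZ2 : ∀ n, MemLp (Z n) 2 μ := fun n =>
    MemLp.of_bound (hZm n).aestronglyMeasurable _ (hZb n)
  have hZE : ∀ n, ∫ x, Z n x ∂μ = 0 := by
    intro n
    simp only [hZ]
    rw [integral_div, integral_finsetSum _ (fun j _ => hvi j)]
    simp [hvz]
  have hZv : ∀ n, ∫ x, (Z n x)^2 ∂μ ≤ D * Lv^2 := by
    intro n
    rcases Nat.eq_zero_or_pos n with rfl | hn
    · simp [hZ]; positivity
    have hn' : (0:ℝ) < n := by exact_mod_cast hn
    have hs : 0 < Real.sqrt n := Real.sqrt_pos.2 hn'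
    have hmain := hvar n hn (fun z => (∑ j ∈ Finset.range n, v (zext n z j)) / Real.sqrt n)
      (fun _ => Lv / Real.sqrt n) (by
        intro j z zz hz
        have := zext_diff v Lv hv_lip n n j z zz hz
        rw [if_pos j.2] at this
        rw [← sub_div, abs_div, abs_of_pos hs, div_mul_eq_mul_div]
        gcongr)
    simp_rw [zext_orbit T v n n le_rfl] at hmain
    have e0 : ∫ y, (∑ j ∈ Finset.range n, v (T^[j] y)) / Real.sqrt n ∂μ = 0 := hZE n
    rw [e0] at hmain
    simp only [sub_zero] at hmain
    refine hmain.trans (le_of_eq ?_)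
    rw [Finset.sum_const, Finset.card_univ, Fintype.card_fin, div_pow, Real.sq_sqrt hn'.le,
      nsmul_eq_mul]
    field_simp
  -- distribution of Z n
  let P : ℕ → ProbabilityMeasure ℝ := fun n =>
    ⟨μ.map (Z n), Measure.isProbabilityMeasure_map (hZm n).aemeasurable⟩
  let QP : ProbabilityMeasure ℝ := ⟨Q, inferInstance⟩
  have hQ2 : Integrable (fun x : ℝ => x^2) Q := by
    have := (ProbabilityTheory.memLp_id_gaussianReal (μ := 0) (v := σ2.toNNReal) 2).integrable_sq
    simpa using this
  have hweak : Tendsto P atTop (𝓝 QP) := by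
    refine weak_of_cdf P QP fun t => ?_
    have e1 : (QP : Measure ℝ).real (Iic t) = _ := cdf_gauss σ2 hσ2_pos t
    rw [e1]
    refine (hclt (t / Real.sqrt σ2)).congr fun n => ?_
    show _ = (μ.map (Z n)).real (Iic t)
    rw [map_measureReal_apply (hZm n) measurableSet_Iic, measureReal_def]
    congr 2
    ext x
    have hs : 0 < Real.sqrt σ2 := Real.sqrt_pos.2 hσ2_pos
    simp only [hZ, mem_ofPred_eq, mem_preimage, mem_Iic]
    rw [le_div_iff₀ hs, mul_comm (Real.sqrt σ2), ← div_div, div_mul_cancel₀ _ hs.ne']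
  have hexp : ∀ (f : ℝ → ℝ) (L : NNReal), LipschitzWith L f → (∀ x, 0 ≤ f x) →
      Tendsto (fun n => ∫ x, f (Z n x) ∂μ) atTop (𝓝 (∫ x, f x ∂Q)) := by
    intro f L hf hf0
    have := lip_expect P QP hweak (D * Lv^2) ?_ ?_ hQ2 hf hf0
    · refine this.congr fun n => ?_
      exact integral_map (hZm n).aemeasurable hf.continuous.aestronglyMeasurable
    · intro n
      show Integrable (fun x : ℝ => x^2) (μ.map (Z n))
      rw [integrable_map_measure (by fun_prop) (hZm n).aemeasurable]
      exact (hZ2 n).integrable_sq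
    · intro n
      show ∫ x, x^2 ∂(μ.map (Z n)) ≤ _
      rw [integral_map (hZm n).aemeasurable (by fun_prop)]
      exact hZv n
  have hconv : ∀ (f : ℝ → ℝ) (L : NNReal), LipschitzWith L f → (∀ x, 0 ≤ f x) →
      ∀ᵐ x ∂μ, Tendsto (fun n => ∫ y, f y ∂(weightedEmpirical T v n x)) atTop
        (𝓝 (∫ y, f y ∂Q)) := by
    intro f L hf hf0
    have := ae_conv μ (fun k x => f (Z k x)) (fun k x => hf0 _) ?_ _ (hexp f L hf hf0)
      (D * (9 * L^2 * Lv^2)) (fun n hn => orb_var T μ D hD hvar v Lv hv_lip f L hf n hn)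
    · filter_upwards [this] with x hx
      refine hx.congr' ?_
      filter_upwards [eventually_ge_atTop 1] with n hn
      exact (integral_we T v n x hn f).symm
    · intro k
      refine MemLp.of_bound (hf.continuous.measurable.comp (hZm k)).aestronglyMeasurable
        (|f 0| + L * ((k * B) / Real.sqrt k)) ?_
      filter_upwards [hZb k] with x hx
      have h1 := hf.dist_le_mul (Z k x) 0
      rw [Real.dist_eq, Real.dist_eq, sub_zero] at h1
      rw [Real.norm_eq_abs]
      have h2 : |f (Z k x)| ≤ |f (Z k x) - f 0| + |f 0| := by
        simpa using abs_add_le (f (Z k x) - f 0) (f 0)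
      have h3 : (L:ℝ) * |Z k x| ≤ L * ((k * B) / Real.sqrt k) := by gcongr
      linarith
  have hr : ∀ᵐ x ∂μ, ∀ p i, Tendsto (fun n => ∫ y, ramp p i y ∂(weightedEmpirical T v n x)) atTop
        (𝓝 (∫ y, ramp p i y ∂Q)) := by
    rw [ae_all_iff]; intro p; rw [ae_all_iff]; intro i
    exact hconv _ _ (ramp_lip p i) (ramp_nonneg p i)
  have ht : ∀ᵐ x ∂μ, ∀ p, Tendsto (fun n => ∫ y, tailf p y ∂(weightedEmpirical T v n x)) atTop
        (𝓝 (∫ y, tailf p y ∂Q)) := by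
    rw [ae_all_iff]; intro p
    exact hconv _ _ (tailf_lip p) (tailf_nonneg p)
  filter_upwards [hr, ht] with x hrx htx
  refine kd_tendsto _ Q ?_ (id_integrable hQ2) hrx htx
  filter_upwards [eventually_ge_atTop 1] with n hn
  exact we_prob T v n x hn

end ASCLT

/-- **Almost-sure central limit theorem** in Kantorovich distance for the
intermittent interval map: for `μ`-a.e. `x`, `κ(𝒜_n(x), 𝒩(0,σ_v²)) → 0`. -/
theorem almost_sure_clt_intermittent_map
    (α : ℝ) (hα0 : 0 < α) (hα1 : α < 4 - Real.sqrt 15)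
    (T : ℝ → ℝ) (hT_maps : MapsTo T (Icc (0:ℝ) 1) (Icc (0:ℝ) 1))
    (hT_formula : ∀ x ∈ Ico (0:ℝ) (1/2), T x = x + (2:ℝ) ^ α * x ^ (1 + α))
    (T' : ℝ → ℝ)
    (hT_deriv : ∀ x ∈ Icc (1/2:ℝ) 1, HasDerivWithinAt T (T' x) (Icc (1/2:ℝ) 1) x)
    (hT_C2 : ContDiffOn ℝ 2 T (Icc (1/2:ℝ) 1))
    (hT_bij : BijOn T (Icc (1/2:ℝ) 1) (Icc (0:ℝ) 1))
    (hT_expanding : ∀ x ∈ Icc (1/2:ℝ) 1, 1 < |T' x|)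
    (h : ℝ → ℝ) (c₁ c₂ : ℝ) (hc₁ : 0 < c₁) (hc₁₂ : c₁ ≤ c₂)
    (hdens : ∀ x ∈ Ioc (0:ℝ) 1, c₁ * x ^ (-α) ≤ h x ∧ h x ≤ c₂ * x ^ (-α))
    (μ : Measure ℝ) (hprob : IsProbabilityMeasure μ)
    (hμ : μ = (volume.restrict (Icc (0:ℝ) 1)).withDensity (fun x => ENNReal.ofReal (h x)))
    (hinv : MeasurePreserving T μ μ)
    -- correlation decay estimate
    (C₀ : ℝ) (hC₀ : 0 < C₀)
    (hdecay : ∀ (v w : ℝ → ℝ) (Mv : ℝ) (Lw : NNReal),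
      ContinuousOn v (Icc (0:ℝ) 1) → (∀ x ∈ Icc (0:ℝ) 1, |v x| ≤ Mv) →
      LipschitzOnWith Lw w (Icc (0:ℝ) 1) →
      ∀ ℓ : ℕ, 1 ≤ ℓ →
        |(∫ x, v (T^[ℓ] x) * w x ∂μ) - (∫ x, v x ∂μ) * (∫ x, w x ∂μ)|
          ≤ C₀ * Mv * (Lw : ℝ) * (ℓ : ℝ) ^ (1 - 1/α))
    -- variance (Devroye) inequality
    (D : ℝ) (hD : 0 < D)
    (hvar : ∀ n : ℕ, 1 ≤ n → ∀ (K : (Fin n → ℝ) → ℝ) (L : Fin n → ℝ),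
      (∀ (j : Fin n) (z zz : Fin n → ℝ), (∀ i, i ≠ j → z i = zz i) →
        |K z - K zz| ≤ L j * |z j - zz j|) →
      ∫ x, (K (fun i => T^[(i:ℕ)] x) - ∫ y, K (fun i => T^[(i:ℕ)] y) ∂μ) ^ 2 ∂μ
        ≤ D * ∑ j, (L j) ^ 2)
    -- the observable
    (v : ℝ → ℝ) (Lv : NNReal) (hv_lip : LipschitzWith Lv v)
    (hv_mean : ∫ x, v x ∂μ = 0)
    -- σ_v² = Cov_v(0) + 2 ∑_{ℓ ≥ 1} Cov_v(ℓ)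
    (σ2 : ℝ)
    (hσ2 : σ2 = (∫ x, v x * v x ∂μ) +
      2 * ∑' ℓ : ℕ, ∫ x, v (T^[ℓ + 1] x) * v x ∂μ)
    (hσ2_pos : 0 < σ2)
    -- the central limit theorem for v
    (hclt : ∀ t : ℝ,
      Tendsto (fun n : ℕ =>
          (μ {x | (∑ j ∈ Finset.range n, v (T^[j] x)) / (Real.sqrt σ2 * Real.sqrt n) ≤ t}).toReal)
        atTop
        (𝓝 ((Real.sqrt (2 * Real.pi))⁻¹ * ∫ ξ in Iic t, Real.exp (-ξ ^ 2 / 2)))) :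
    ∀ᵐ x ∂μ, Tendsto
      (fun n : ℕ => kantorovichDist (weightedEmpirical T v n x)
        (ProbabilityTheory.gaussianReal 0 σ2.toNNReal))
      atTop (𝓝 0) := by
  have hsupp : ∀ᵐ x ∂μ, x ∈ Icc (0:ℝ) 1 := by
    rw [hμ]
    exact (withDensity_absolutelyContinuous _ _).ae_le (ae_restrict_mem measurableSet_Icc)
  exact ASCLT.main_aux T hT_maps μ hprob hsupp hinv D hD hvar v Lv hv_lip hv_mean σ2 hσ2_pos hclt
end

section
/- For every measurable set A ⊆ [0,1] with μ(A) > 0, every integer n ≥ 1, every t > 0 and every ε > 0, μ( { x ∈ [0,1] : 𝒵'_{A,ε}(x) ≥ (1/(ε^{2/3}·n^{1/3}))·( t + 2^{4/3}·D^{1/3}/μ(A) ) } ) ≤ D / (ε^{2/3}·n^{1/3}·t²). -/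
open MeasureTheory Set

theorem aux_iInf_lip {n : ℕ} (T : ℝ → ℝ) (A : Set ℝ) (hA : A.Nonempty) (z zz : Fin n → ℝ) :
    |(⨅ y : A, ∑ i : Fin n, |z i - T^[(i:ℕ)] y|) - (⨅ y : A, ∑ i : Fin n, |zz i - T^[(i:ℕ)] y|)|
      ≤ ∑ i, |z i - zz i| := by
  haveI : Nonempty A := hA.to_subtype
  have key : ∀ z zz : Fin n → ℝ, (⨅ y : A, ∑ i : Fin n, |z i - T^[(i:ℕ)] y|)
      ≤ (⨅ y : A, ∑ i : Fin n, |zz i - T^[(i:ℕ)] y|) + ∑ i, |z i - zz i| := by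
    intro z zz
    rw [← sub_le_iff_le_add]
    refine le_ciInf fun y => ?_
    rw [sub_le_iff_le_add, ← Finset.sum_add_distrib]
    refine (ciInf_le ⟨0, ?_⟩ y).trans (Finset.sum_le_sum fun i _ => ?_)
    · rintro _ ⟨w, rfl⟩
      positivity
    · have := abs_sub_le (z i) (zz i) (T^[(i:ℕ)] y)
      linarith
  have h1 := key z zz
  have h2 := key zz z
  simp only [abs_sub_comm (zz _) (z _)] at h2
  rw [abs_sub_le_iff]
  constructor <;> linarith

theorem aux_arith {a c d e m E : ℝ} (ha : 0 < a) (hc : 0 < c) (hd : 0 < d) (he : 0 < e)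
    (he3 : e ^ 3 = 2) (hm : 0 < m) (hm1 : m ≤ 1) (hE : m * E ^ 2 ≤ d ^ 3 / c ^ 3)
    (hcase : 2 * e * d ≤ a ^ 2 * c * m) : E ≤ 2 * e * a * d / (c * m) := by
  by_contra hlt
  push Not at hlt
  rw [div_lt_iff₀ (by positivity)] at hlt
  rw [le_div_iff₀ (by positivity)] at hE
  have h1 : (2 * e * a * d) ^ 2 < (E * (c * m)) ^ 2 :=
    pow_lt_pow_left₀ hlt (by positivity) (by norm_num)
  have h2 : (2 * e * a * d) ^ 2 * c < d ^ 3 * m := by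
    calc (2 * e * a * d) ^ 2 * c < (E * (c * m)) ^ 2 * c := by gcongr
      _ = (m * E ^ 2 * c ^ 3) * m := by ring
      _ ≤ d ^ 3 * m := by gcongr
  have h3 : (2 * e * d) * (4 * e ^ 2 * d ^ 2) ≤ (a ^ 2 * c * m) * (4 * e ^ 2 * d ^ 2) := by gcongr
  have h4 : 16 * d ^ 3 < d ^ 3 * m * m := by
    calc 16 * d ^ 3 = (2 * e * d) * (4 * e ^ 2 * d ^ 2) := by
            linear_combination (-8 * d ^ 3) * he3
      _ ≤ (a ^ 2 * c * m) * (4 * e ^ 2 * d ^ 2) := h3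
      _ = ((2 * e * a * d) ^ 2 * c) * m := by ring
      _ < d ^ 3 * m * m := by gcongr
  have h5 : m * m ≤ 1 := by nlinarith
  have h6 : 0 < d ^ 3 := by positivity
  nlinarith

theorem aux_rpow3 {x : ℝ} (hx : 0 < x) : (x ^ ((1:ℝ)/3)) ^ 3 = x := by
  rw [← Real.rpow_natCast, ← Real.rpow_mul hx.le]
  norm_num

theorem aux_rpow23 {x : ℝ} (hx : 0 < x) : x ^ ((2:ℝ)/3) = (x ^ ((1:ℝ)/3)) ^ 2 := by
  rw [← Real.rpow_natCast, ← Real.rpow_mul hx.le]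
  norm_num

/-- **Mismatch estimate** for the intermittent interval map: for every
measurable `A ⊆ [0,1]` with `μ(A) > 0`, every `n ≥ 1`, every `t > 0` and every
`ε > 0`, `μ{x : 𝒵'_{A,ε}(x) ≥ (1/(ε^{2/3} n^{1/3}))(t + 2^{4/3} D^{1/3}/μ(A))}
  ≤ D/(ε^{2/3} n^{1/3} t²)`, where
`𝒵'_{A,ε}(x) = (1/n) inf_{y ∈ A} Card{0 ≤ j ≤ n-1 : |T^j x - T^j y| > ε}`. -/
theorem mismatch_intermittent_map
    (α : ℝ) (hα0 : 0 < α) (hα1 : α < 4 - Real.sqrt 15)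
    (T : ℝ → ℝ) (hT_maps : MapsTo T (Icc (0:ℝ) 1) (Icc (0:ℝ) 1))
    (hT_formula : ∀ x ∈ Ico (0:ℝ) (1/2), T x = x + (2:ℝ) ^ α * x ^ (1 + α))
    (T' : ℝ → ℝ)
    (hT_deriv : ∀ x ∈ Icc (1/2:ℝ) 1, HasDerivWithinAt T (T' x) (Icc (1/2:ℝ) 1) x)
    (hT_C2 : ContDiffOn ℝ 2 T (Icc (1/2:ℝ) 1))
    (hT_bij : BijOn T (Icc (1/2:ℝ) 1) (Icc (0:ℝ) 1))
    (hT_expanding : ∀ x ∈ Icc (1/2:ℝ) 1, 1 < |T' x|)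
    (h : ℝ → ℝ) (c₁ c₂ : ℝ) (hc₁ : 0 < c₁) (hc₁₂ : c₁ ≤ c₂)
    (hdens : ∀ x ∈ Ioc (0:ℝ) 1, c₁ * x ^ (-α) ≤ h x ∧ h x ≤ c₂ * x ^ (-α))
    (μ : Measure ℝ) (hprob : IsProbabilityMeasure μ)
    (hμ : μ = (volume.restrict (Icc (0:ℝ) 1)).withDensity (fun x => ENNReal.ofReal (h x)))
    (hinv : MeasurePreserving T μ μ)
    -- variance (Devroye) inequality
    (D : ℝ) (hD : 0 < D)
    (hvar : ∀ n : ℕ, 1 ≤ n → ∀ (K : (Fin n → ℝ) → ℝ) (L : Fin n → ℝ),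
      (∀ (j : Fin n) (z zz : Fin n → ℝ), (∀ i, i ≠ j → z i = zz i) →
        |K z - K zz| ≤ L j * |z j - zz j|) →
      ∫ x, (K (fun i => T^[(i:ℕ)] x) - ∫ y, K (fun i => T^[(i:ℕ)] y) ∂μ) ^ 2 ∂μ
        ≤ D * ∑ j, (L j) ^ 2) :
    ∀ A : Set ℝ, A ⊆ Icc (0:ℝ) 1 → MeasurableSet A → 0 < μ A →
    ∀ n : ℕ, 1 ≤ n → ∀ t : ℝ, 0 < t → ∀ ε : ℝ, 0 < ε →
      μ {x | x ∈ Icc (0:ℝ) 1 ∧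
          (1 / (n : ℝ)) *
            sInf {r : ℝ | ∃ y ∈ A, r =
              (((Finset.range n).filter (fun j => ε < |T^[j] x - T^[j] y|)).card : ℝ)}
          ≥ (1 / (ε ^ ((2:ℝ)/3) * (n : ℝ) ^ ((1:ℝ)/3))) *
              (t + (2:ℝ) ^ ((4:ℝ)/3) * D ^ ((1:ℝ)/3) / (μ A).toReal)}
        ≤ ENNReal.ofReal (D / (ε ^ ((2:ℝ)/3) * (n : ℝ) ^ ((1:ℝ)/3) * t ^ 2)) := by
  intro A hA01 hAm hA n hn t ht ε hε
  have hAne : A.Nonempty := nonempty_of_measure_ne_zero hA.ne'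
  haveI : Nonempty A := hAne.to_subtype
  have hn0 : (0:ℝ) < n := by exact_mod_cast hn
  obtain ⟨y₀, hy₀⟩ := hAne
  have hit : ∀ (j : ℕ) (x : ℝ), x ∈ Icc (0:ℝ) 1 → T^[j] x ∈ Icc (0:ℝ) 1 := fun j x hx =>
    hT_maps.iterate j hx
  set K : (Fin n → ℝ) → ℝ := fun z => (1 / (n:ℝ)) * ⨅ y : A, ∑ i : Fin n, |z i - T^[(i:ℕ)] y|
    with hK
  have hlip : ∀ z zz : Fin n → ℝ, |K z - K zz| ≤ (1 / (n:ℝ)) * ∑ i, |z i - zz i| := by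
    intro z zz
    simp only [hK]
    rw [← mul_sub, abs_mul, abs_of_pos (by positivity : (0:ℝ) < 1 / n)]
    gcongr
    exact aux_iInf_lip T A ⟨y₀, hy₀⟩ z zz
  have hKcont : Continuous K := by
    refine (LipschitzWith.of_dist_le_mul (K := 1) fun z zz => ?_).continuous
    rw [Real.dist_eq]
    refine (hlip z zz).trans ?_
    have : ∑ i, |z i - zz i| ≤ ∑ i : Fin n, dist z zz := by
      refine Finset.sum_le_sum fun i _ => ?_
      rw [← Real.dist_eq]
      exact dist_le_pi_dist z zz i
    rw [Finset.sum_const, Finset.card_univ, Fintype.card_fin, nsmul_eq_mul] at this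
    calc (1 / (n:ℝ)) * ∑ i, |z i - zz i| ≤ (1 / (n:ℝ)) * (n * dist z zz) := by gcongr
      _ = _ := by
        push_cast
        field_simp
  have hbdd : ∀ z : Fin n → ℝ, BddBelow (range fun y : A => ∑ i : Fin n, |z i - T^[(i:ℕ)] y|) := by
    intro z
    refine ⟨0, ?_⟩
    rintro _ ⟨w, rfl⟩
    positivity
  have hK0 : ∀ z, 0 ≤ K z := by
    intro z
    refine mul_nonneg (by positivity) (Real.iInf_nonneg fun y => by positivity)
  set X : ℝ → ℝ := fun x => K (fun i => T^[(i:ℕ)] x) with hX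
  have hXm : Measurable X := by
    refine hKcont.measurable.comp (measurable_pi_lambda _ fun i => ?_)
    exact hinv.measurable.iterate _
  have hX1 : ∀ x ∈ Icc (0:ℝ) 1, X x ≤ 1 := by
    intro x hx
    have h1 : (⨅ y : A, ∑ i : Fin n, |T^[(i:ℕ)] x - T^[(i:ℕ)] y|) ≤ n := by
      refine (ciInf_le (hbdd fun i => T^[(i:ℕ)] x) ⟨y₀, hy₀⟩).trans ?_
      calc _ ≤ ∑ i : Fin n, (1:ℝ) := by
            refine Finset.sum_le_sum fun i _ => ?_
            have h1 := hit i x hx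
            have h2 := hit i y₀ (hA01 hy₀)
            rw [abs_sub_le_iff]
            constructor <;> linarith [h1.1, h1.2, h2.1, h2.2]
        _ = n := by simp
    calc X x = (1 / (n:ℝ)) * (⨅ y : A, ∑ i : Fin n, |T^[(i:ℕ)] x - T^[(i:ℕ)] y|) := rfl
      _ ≤ (1 / (n:ℝ)) * n := by gcongr
      _ = 1 := by field_simp
  have hXA : ∀ x ∈ A, X x = 0 := by
    intro x hx
    refine le_antisymm ?_ (hK0 _)
    have h1 : (⨅ y : A, ∑ i : Fin n, |T^[(i:ℕ)] x - T^[(i:ℕ)] y|) ≤ 0 := by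
      refine (ciInf_le (hbdd fun i => T^[(i:ℕ)] x) ⟨x, hx⟩).trans ?_
      simp
    exact mul_nonpos_of_nonneg_of_nonpos (by positivity) h1
  have hae : ∀ᵐ x ∂μ, x ∈ Icc (0:ℝ) 1 := by
    rw [hμ]
    exact (withDensity_absolutelyContinuous _ _).ae_le (ae_restrict_mem measurableSet_Icc)
  have hXL : MemLp X 2 μ := by
    refine MemLp.of_bound hXm.aestronglyMeasurable 1 ?_
    filter_upwards [hae] with x hx
    rw [Real.norm_eq_abs, abs_of_nonneg (hK0 _)]
    exact hX1 x hx
  set E : ℝ := ∫ x, X x ∂μ with hE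
  have hE0 : 0 ≤ E := integral_nonneg fun x => hK0 _
  have hV : ProbabilityTheory.variance X μ ≤ D / n := by
    rw [ProbabilityTheory.variance_eq_integral hXm.aemeasurable]
    refine (hvar n hn K (fun _ => 1 / (n:ℝ)) ?_).trans ?_
    · intro j z zz hz
      refine (hlip z zz).trans ?_
      gcongr
      rw [Finset.sum_eq_single j]
      · intro i _ hi
        rw [hz i hi]
        simp
      · simp
    · rw [Finset.sum_const, Finset.card_univ, Fintype.card_fin, nsmul_eq_mul]
      apply le_of_eq
      field_simp
  have hcheb : ∀ s : ℝ, 0 < s → μ {x | s ≤ |X x - E|} ≤ ENNReal.ofReal (D / n / s ^ 2) := by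
    intro s hs
    refine (ProbabilityTheory.meas_ge_le_variance_div_sq hXL hs).trans ?_
    apply ENNReal.ofReal_le_ofReal
    gcongr
  set m : ℝ := (μ A).toReal with hm
  have hm0 : 0 < m := ENNReal.toReal_pos hA.ne' (measure_ne_top _ _)
  have hm1 : m ≤ 1 := ENNReal.toReal_le_of_le_ofReal zero_le_one (by simpa using prob_le_one)
  have hEm : m * E ^ 2 ≤ D / n := by
    rcases hE0.eq_or_lt with h0 | h0
    · rw [← h0]
      simp only [ne_eq, OfNat.ofNat_ne_zero, not_false_eq_true, zero_pow, mul_zero]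
      positivity
    · have h1 : μ A ≤ ENNReal.ofReal (D / n / E ^ 2) := by
        refine le_trans (measure_mono fun x hx => ?_) (hcheb E h0)
        rw [mem_setOf_eq, hXA x hx, zero_sub, abs_neg]
        exact le_abs_self E
      have h2 : m ≤ D / n / E ^ 2 := ENNReal.toReal_le_of_le_ofReal (by positivity) h1
      rwa [le_div_iff₀ (by positivity)] at h2
  have ha := Real.rpow_pos_of_pos hε ((1:ℝ)/3)
  have hc := Real.rpow_pos_of_pos hn0 ((1:ℝ)/3)
  have hd := Real.rpow_pos_of_pos hD ((1:ℝ)/3)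
  have he := Real.rpow_pos_of_pos (two_pos : (0:ℝ) < 2) ((1:ℝ)/3)
  have ha3 := aux_rpow3 hε
  have hc3 := aux_rpow3 hn0
  have hd3 := aux_rpow3 hD
  have he3 := aux_rpow3 (two_pos : (0:ℝ) < 2)
  have h243 : (2:ℝ) ^ ((4:ℝ)/3) = 2 * (2:ℝ) ^ ((1:ℝ)/3) := by
    rw [show (4:ℝ)/3 = 1 + 1/3 by norm_num, Real.rpow_add two_pos, Real.rpow_one]
  rw [aux_rpow23 hε, h243]
  generalize ε ^ ((1:ℝ)/3) = a at *
  generalize (n:ℝ) ^ ((1:ℝ)/3) = c at *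
  generalize D ^ ((1:ℝ)/3) = d at *
  generalize (2:ℝ) ^ ((1:ℝ)/3) = e at *
  have hbdd2 : ∀ x, BddBelow {r : ℝ | ∃ y ∈ A, r =
      (((Finset.range n).filter (fun j => ε < |T^[j] x - T^[j] y|)).card : ℝ)} := by
    intro x
    refine ⟨0, ?_⟩
    rintro _ ⟨y, _, rfl⟩
    positivity
  by_cases hcase : 2 * e * d ≤ a ^ 2 * c * m
  · have hEq := aux_arith ha hc hd he he3 hm0 hm1 (by rw [hd3, hc3]; exact hEm) hcase
    have hs : 0 < a * t / c := by positivity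
    refine le_trans (measure_mono fun x hx => ?_) ((hcheb (a * t / c) hs).trans_eq ?_)
    · obtain ⟨_, hx2⟩ := hx
      refine le_trans ?_ (le_abs_self (X x - E))
      set S := sInf {r : ℝ | ∃ y ∈ A, r =
        (((Finset.range n).filter (fun j => ε < |T^[j] x - T^[j] y|)).card : ℝ)} with hS
      have h1 : ε * S ≤ ⨅ y : A, ∑ i : Fin n, |T^[(i:ℕ)] x - T^[(i:ℕ)] y| := by
        refine le_ciInf fun y => ?_
        have h2 : S ≤ (((Finset.range n).filter
            (fun j => ε < |T^[j] x - T^[j] (y:ℝ)|)).card : ℝ) := csInf_le (hbdd2 x) ⟨y, y.2, rfl⟩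
        rw [Fin.sum_univ_eq_sum_range (fun i => |T^[i] x - T^[i] (y:ℝ)|) n]
        calc ε * S ≤ ε * (((Finset.range n).filter
            (fun j => ε < |T^[j] x - T^[j] (y:ℝ)|)).card : ℝ) := by gcongr
          _ = ∑ j ∈ (Finset.range n).filter (fun j => ε < |T^[j] x - T^[j] (y:ℝ)|), ε := by
            rw [Finset.sum_const, nsmul_eq_mul, mul_comm]
          _ ≤ ∑ j ∈ (Finset.range n).filter (fun j => ε < |T^[j] x - T^[j] (y:ℝ)|),
              |T^[j] x - T^[j] (y:ℝ)| :=
            Finset.sum_le_sum fun j hj => (Finset.mem_filter.1 hj).2.le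
          _ ≤ _ := Finset.sum_le_sum_of_subset_of_nonneg (Finset.filter_subset _ _)
            fun _ _ _ => abs_nonneg _
      have h3 : ε * ((1 / (n:ℝ)) * S) ≤ X x := by
        calc ε * ((1 / (n:ℝ)) * S) = (1 / (n:ℝ)) * (ε * S) := by ring
          _ ≤ (1 / (n:ℝ)) * (⨅ y : A, ∑ i : Fin n, |T^[(i:ℕ)] x - T^[(i:ℕ)] y|) := by gcongr
          _ = X x := rfl
      have h4 := mul_le_mul_of_nonneg_left hx2 hε.le
      have h5 : ε * (1 / (a ^ 2 * c) * (t + 2 * e * d / m))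
          = a * t / c + 2 * e * a * d / (c * m) := by
        rw [← ha3]
        field_simp
      linarith
    · congr 1
      rw [← hc3]
      field_simp
  · push Not at hcase
    refine le_trans (le_of_eq ?_) zero_le
    convert measure_empty (μ := μ)
    rw [eq_empty_iff_forall_notMem]
    rintro x ⟨_, hx2⟩
    have h1 : sInf {r : ℝ | ∃ y ∈ A, r =
        (((Finset.range n).filter (fun j => ε < |T^[j] x - T^[j] y|)).card : ℝ)} ≤ n := by
      refine (csInf_le (hbdd2 x) ⟨y₀, hy₀, rfl⟩).trans ?_
      exact_mod_cast (Finset.card_filter_le _ _).trans (by simp)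
    have h2 : (1 / (n:ℝ)) * sInf {r : ℝ | ∃ y ∈ A, r =
        (((Finset.range n).filter (fun j => ε < |T^[j] x - T^[j] y|)).card : ℝ)} ≤ 1 := by
      rw [one_div, inv_mul_le_iff₀ hn0, mul_one]
      exact h1
    have h3 := hx2.le.trans h2
    rw [one_div, inv_mul_le_iff₀ (by positivity), mul_one] at h3
    have h4 : 2 * e * d / m < a ^ 2 * c := by linarith
    rw [div_lt_iff₀ hm0] at h4
    linarith
end
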